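/- Let (g,B) and (g',B') be quadratic Lie algebras with double-extension data (X0,Y0) and (X0',Y0') respectively, and set q := {x in g : B(x,X0) = B(x,Y0) = 0} and q' := {x' in g' : B'(x',X0') = B'(x',Y0') = 0} (note that [Y0,x] lies in q for every x in q, and similarly for q'). Then there exists a Lie algebra isomorphism A : g → g' if and only if there exist λ in ℂ with λ ≠ 0, a linear bijection Q̄ : q → q' and a linear bijection P̄ : q → q such that: (i) [Y0', Q̄(x)] = λ·Q̄([Y0, x]) for all x in q; (ii) B(P̄([Y0,x]), P̄(y)) = B([Y0,x], y) for all x,y in q; (iii) B'(Q̄(x), Q̄(y)) = B(P̄(x), P̄(y)) for all x,y in q. -/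

import Mathlib

/-- The subspace `{x ∈ g : B(x,X0) = B(x,Y0) = 0}`, the orthogonal of `span{X0,Y0}`. -/
noncomputable def orthoPair {g : Type*} [LieRing g] [LieAlgebra ℂ g]
    (B : LinearMap.BilinForm ℂ g) (X0 Y0 : g) : Submodule ℂ g :=
  LinearMap.ker (B.flip X0) ⊓ LinearMap.ker (B.flip Y0)

section LinearAlgebra

open Module
open LinearMap (BilinForm)

variable {V V' : Type*} [AddCommGroup V] [Module ℂ V] [FiniteDimensional ℂ V]
  [AddCommGroup V'] [Module ℂ V'] [FiniteDimensional ℂ V']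

/-- Linearly independent families indexed by the same type in spaces of equal dimension are
matched by some linear equivalence. -/
theorem LinearIndependent.exists_linearEquiv_apply_eq {ι : Type*} {u : ι → V} {u' : ι → V'}
    (hu : LinearIndependent ℂ u) (hu' : LinearIndependent ℂ u')
    (hdim : finrank ℂ V = finrank ℂ V') : ∃ e : V ≃ₗ[ℂ] V', ∀ i, e (u i) = u' i := by
  let e₀ := LinearEquiv.ofFinrankEq V V' hdim
  have hw : LinearIndependent ℂ (e₀ ∘ u) := hu.map' e₀.toLinearMap e₀.ker
  obtain ⟨g, hg⟩ := Submodule.exists_linearEquiv_restrict_eq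
    ((Basis.span hw).equiv (Basis.span hu') (Equiv.refl ι))
  refine ⟨e₀.trans g, fun i => ?_⟩
  have h := hg (Basis.span hw i)
  rw [Basis.equiv_apply, Basis.span_apply, Basis.span_apply] at h
  exact h.symm

/-- Two nondegenerate symmetric complex bilinear forms on the same space are isometric. -/
theorem LinearMap.BilinForm.exists_linearEquiv_isometry {b c : BilinForm ℂ V}
    (hb : ∀ x y, b x y = b y x) (hc : ∀ x y, c x y = c y x)
    (hbn : b.SeparatingLeft) (hcn : c.SeparatingLeft) :
    ∃ P : V ≃ₗ[ℂ] V, ∀ x y, c x y = b (P x) (P y) := by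
  have hb' := QuadraticMap.associated_left_inverse ℂ hb
  have hc' := QuadraticMap.associated_left_inverse ℂ hc
  obtain ⟨P⟩ := QuadraticForm.equivalent_of_isAlgClosed c.toQuadraticMap b.toQuadraticMap
    (by rwa [hc']) (by rwa [hb'])
  refine ⟨P.toLinearEquiv, fun x y => ?_⟩
  have hP : ∀ v, b (P v) (P v) = c v v := P.map_app
  have h := hP (x + y)
  have hadd : P (x + y) = P x + P y := P.toLinearEquiv.map_add x y
  simp only [hadd, map_add, LinearMap.add_apply, hP, hb (P y) (P x), hc y x] at h
  change c x y = b (P x) (P y)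
  linear_combination -h / 2

omit [FiniteDimensional ℂ V'] in
/-- A linear equivalence intertwining skew endomorphisms up to a scalar, and transporting the
associated alternating forms with the same scalar, comes with an isometry correction `P`. -/
theorem exists_isometry_correction {b : BilinForm ℂ V} {b' : BilinForm ℂ V'}
    (hb : ∀ x y, b x y = b y x) (hb' : ∀ x y, b' x y = b' y x)
    (hbn : b.SeparatingLeft) (hbn' : b'.SeparatingLeft)
    {D : V →ₗ[ℂ] V} {D' : V' →ₗ[ℂ] V'} {lam : ℂ} (hlam : lam ≠ 0) (Q : V ≃ₗ[ℂ] V')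
    (hQ : ∀ x, D' (Q x) = lam • Q (D x))
    (hω : ∀ x y, b' (D' (Q x)) (Q y) = lam * b (D x) y) :
    ∃ P : V ≃ₗ[ℂ] V, (∀ x y, b (P (D x)) (P y) = b (D x) y) ∧
      ∀ x y, b' (Q x) (Q y) = b (P x) (P y) := by
  obtain ⟨P, hP⟩ := BilinForm.exists_linearEquiv_isometry
    (b := b) (c := b'.compl₁₂ Q.toLinearMap Q.toLinearMap) hb (fun x y => hb' _ _) hbn
    (fun x hx => by
      have : Q x = 0 := hbn' _ fun y => by simpa using hx (Q.symm y)
      simpa using this)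
  replace hP : ∀ x y, b' (Q x) (Q y) = b (P x) (P y) := hP
  refine ⟨P, fun x y => ?_, hP⟩
  have h := hω x y
  rw [hQ, map_smul, LinearMap.smul_apply, smul_eq_mul] at h
  rw [← hP]
  exact mul_left_cancel₀ hlam h

/-- The normal form of a nonzero skew endomorphism of rank at most two. -/
structure IsSymplecticPair (b : BilinForm ℂ V) (D : V →ₗ[ℂ] V) (x₁ x₂ : V) : Prop where
  apply_eq_one : b (D x₁) x₂ = 1
  apply_eq : ∀ v, D v = b (D v) x₂ • D x₁ + b (D x₁) v • D x₂

section Skew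

variable {b : BilinForm ℂ V} {D : V →ₗ[ℂ] V} (hb : ∀ x y, b x y = b y x)
  (hD : ∀ x y, b (D x) y = -b x (D y))

include hb hD

omit [FiniteDimensional ℂ V] in
theorem skew_apply_comm (x y : V) : b (D x) y = -b (D y) x := by rw [hD, hb]

omit [FiniteDimensional ℂ V] in
theorem skew_apply_self (x : V) : b (D x) x = 0 := by
  have h := skew_apply_comm hb hD x x
  linear_combination h / 2

omit [FiniteDimensional ℂ V] in
theorem linearIndependent_of_apply_eq_one {x₁ x₂ : V} (h : b (D x₁) x₂ = 1) :
    LinearIndependent ℂ ![D x₁, D x₂] := by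
  rw [LinearIndependent.pair_iff]
  intro s t hst
  have h₁ := congrArg (fun v => b v x₁) hst
  have h₂ := congrArg (fun v => b v x₂) hst
  have h₃ := skew_apply_comm hb hD x₂ x₁
  simp [skew_apply_self hb hD, h, h₃] at h₁ h₂
  exact ⟨h₂, h₁⟩

theorem isSymplecticPair_of_apply_eq_one (hr : finrank ℂ D.range ≤ 2) {x₁ x₂ : V}
    (h : b (D x₁) x₂ = 1) : IsSymplecticPair b D x₁ x₂ := by
  have hli := linearIndependent_of_apply_eq_one hb hD h
  have hle : Submodule.span ℂ (Set.range ![D x₁, D x₂]) ≤ D.range := by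
    rw [Submodule.span_le]
    rintro _ ⟨i, rfl⟩
    fin_cases i <;> simp
  have heq := Submodule.eq_of_le_of_finrank_le hle (by
    rw [finrank_span_eq_card hli]; simpa using hr)
  refine ⟨h, fun v => ?_⟩
  have hv : D v ∈ Submodule.span ℂ (Set.range ![D x₁, D x₂]) := heq ▸ ⟨v, rfl⟩
  simp only [Matrix.range_cons, Matrix.range_empty, Set.union_empty, Set.singleton_union] at hv
  obtain ⟨α, β, hαβ⟩ := Submodule.mem_span_pair.1 hv
  have h₁ : b (D v) x₁ = -β := by
    simp [← hαβ, skew_apply_self hb hD, skew_apply_comm hb hD x₂ x₁, h]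
  have h₂ : b (D v) x₂ = α := by
    simp [← hαβ, skew_apply_self hb hD, h]
  rw [h₂, skew_apply_comm hb hD x₁ v, h₁, neg_neg, hαβ]

omit [FiniteDimensional ℂ V] in
/-- The rank of an endomorphism with a symplectic pair is two. -/
theorem IsSymplecticPair.finrank_range {x₁ x₂ : V} (h : IsSymplecticPair b D x₁ x₂) :
    finrank ℂ D.range = 2 := by
  have hli := linearIndependent_of_apply_eq_one hb hD h.apply_eq_one
  have heq : D.range = Submodule.span ℂ (Set.range ![D x₁, D x₂]) := by
    apply le_antisymm
    · rintro _ ⟨v, rfl⟩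
      rw [h.apply_eq v]
      exact add_mem (Submodule.smul_mem _ _ (Submodule.subset_span ⟨0, rfl⟩))
        (Submodule.smul_mem _ _ (Submodule.subset_span ⟨1, rfl⟩))
    · rw [Submodule.span_le]
      rintro _ ⟨i, rfl⟩
      fin_cases i <;> simp
  rw [heq, finrank_span_eq_card hli, Fintype.card_fin]

end Skew

section Gluing

variable {b : BilinForm ℂ V} {b' : BilinForm ℂ V'} {D : V →ₗ[ℂ] V} {D' : V' →ₗ[ℂ] V'}
  (hb : ∀ x y, b x y = b y x) (hb' : ∀ x y, b' x y = b' y x)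
  (hD : ∀ x y, b (D x) y = -b x (D y)) (hD' : ∀ x y, b' (D' x) y = -b' x (D' y))

include hb hb' hD hD'

theorem IsSymplecticPair.finrank_ker_eq (hdim : finrank ℂ V = finrank ℂ V')
    {x₁ x₂ : V} {y₁ y₂ : V'} (hx : IsSymplecticPair b D x₁ x₂)
    (hy : IsSymplecticPair b' D' y₁ y₂) : finrank ℂ D.ker = finrank ℂ D'.ker := by
  have h := D.finrank_range_add_finrank_ker
  have h' := D'.finrank_range_add_finrank_ker
  rw [hx.finrank_range hb hD] at h
  rw [hy.finrank_range hb' hD'] at h'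
  omega

/-- An equivalence of kernels extends to an equivalence matching two symplectic pairs. -/
theorem IsSymplecticPair.exists_extension (hdim : finrank ℂ V = finrank ℂ V')
    {x₁ x₂ : V} {y₁ y₂ : V'} (hx : IsSymplecticPair b D x₁ x₂)
    (hy : IsSymplecticPair b' D' y₁ y₂) (e : D.ker ≃ₗ[ℂ] D'.ker) :
    ∃ Q : V ≃ₗ[ℂ] V', Q x₁ = y₁ ∧ Q x₂ = y₂ ∧ (∀ k : D.ker, Q k = e k) ∧
      (∀ v, D' (Q v) = b (D v) x₂ • D' y₁ + b (D x₁) v • D' y₂) ∧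
      ∀ v w, b' (D' (Q v)) (Q w) = b (D v) w := by
  let p : V →ₗ[ℂ] V := LinearMap.id - ((b.flip x₂ ∘ₗ D).smulRight x₁ + (b (D x₁)).smulRight x₂)
  have hp : ∀ v, p v = v - (b (D v) x₂ • x₁ + b (D x₁) v • x₂) := fun v => rfl
  have hpk : ∀ v, p v ∈ D.ker := fun v => by
    rw [LinearMap.mem_ker, hp, map_sub, map_add, map_smul, map_smul, ← hx.apply_eq, sub_self]
  let q : V →ₗ[ℂ] D.ker := p.codRestrict D.ker hpk
  let R : V →ₗ[ℂ] V' := (b.flip x₂ ∘ₗ D).smulRight y₁ + (b (D x₁)).smulRight y₂ +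
    D'.ker.subtype ∘ₗ e.toLinearMap ∘ₗ q
  have hR : ∀ v, R v = b (D v) x₂ • y₁ + b (D x₁) v • y₂ + e (q v) := fun v => rfl
  have hDR : ∀ v, D' (R v) = b (D v) x₂ • D' y₁ + b (D x₁) v • D' y₂ := fun v => by
    rw [hR, map_add, map_add, map_smul, map_smul, LinearMap.mem_ker.1 (e (q v)).2, add_zero]
  have h12 := hx.apply_eq_one
  have h21 : b (D x₂) x₁ = -1 := by rw [skew_apply_comm hb hD, h12]
  have h12' := hy.apply_eq_one
  have h21' : b' (D' y₂) y₁ = -1 := by rw [skew_apply_comm hb' hD', h12']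
  have h11 := skew_apply_self hb hD
  have h11' := skew_apply_self hb' hD'
  have hk : ∀ (k : D'.ker) y, b' (D' y) k = 0 := fun k y => by
    rw [hD', LinearMap.mem_ker.1 k.2, map_zero, neg_zero]
  have hinj : Function.Injective R := by
    rw [← LinearMap.ker_eq_bot, LinearMap.ker_eq_bot']
    intro v hv
    have h0 := (hDR v).symm
    rw [hv, map_zero] at h0
    have h₁ := congrArg (fun v => b' v y₁) h0
    have h₂ := congrArg (fun v => b' v y₂) h0
    simp [h11', h12', h21'] at h₁ h₂
    have hqv : (q v : V) = v := by
      change p v = v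
      simp [hp, h₁, h₂]
    rw [hR] at hv
    simp [h₁, h₂] at hv
    rw [← hqv, hv, ZeroMemClass.coe_zero]
  have hqx : ∀ v : V, p v = 0 → q v = 0 := fun v h => Subtype.ext h
  refine ⟨R.linearEquivOfInjective hinj hdim, ?_, ?_, ?_, hDR, ?_⟩
  · change R x₁ = y₁
    rw [hR, hqx x₁ (by simp [hp, h11, h12])]
    simp [h11, h12]
  · change R x₂ = y₂
    rw [hR, hqx x₂ (by simp [hp, h11, h12])]
    simp [h11, h12]
  · intro k
    change R k = e k
    have hDk : D k = 0 := k.2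
    have hbk : b (D x₁) k = 0 := by rw [hD, hDk, map_zero, neg_zero]
    have hqk : q k = k := Subtype.ext (by change p k = k; simp [hp, hDk, hbk])
    simp [hR, hDk, hbk, hqk]
  · intro v w
    change b' (D' (R v)) (R w) = b (D v) w
    rw [hDR, hR, hx.apply_eq v]
    have h22 : b (D x₂) w = -b (D w) x₂ := skew_apply_comm hb hD _ _
    simp [h11', h12', h21', hk, h22, h11, h12]

theorem IsSymplecticPair.exists_intertwiner_of_linearIndependent {ι : Type*}
    (hdim : finrank ℂ V = finrank ℂ V') {x₁ x₂ : V} {y₁ y₂ : V'}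
    (hx : IsSymplecticPair b D x₁ x₂) (hy : IsSymplecticPair b' D' y₁ y₂)
    {u : ι → D.ker} {u' : ι → D'.ker} (hu : LinearIndependent ℂ u) (hu' : LinearIndependent ℂ u')
    (H : ∀ Q : V ≃ₗ[ℂ] V', Q x₁ = y₁ → Q x₂ = y₂ → (∀ i, Q (u i) = u' i) →
      Q (D x₁) = D' y₁ ∧ Q (D x₂) = D' y₂) :
    ∃ Q : V ≃ₗ[ℂ] V', (∀ x, D' (Q x) = Q (D x)) ∧
      ∀ x y, b' (D' (Q x)) (Q y) = b (D x) y := by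
  obtain ⟨e, he⟩ := hu.exists_linearEquiv_apply_eq hu'
    (hx.finrank_ker_eq hb hb' hD hD' hdim hy)
  obtain ⟨Q, h₁, h₂, hk, hDQ, hω⟩ := hx.exists_extension hb hb' hD hD' hdim hy e
  obtain ⟨h₃, h₄⟩ := H Q h₁ h₂ fun i => by rw [hk, he]
  exact ⟨Q, fun x => by
    rw [hDQ, ← h₃, ← h₄, ← Q.map_smul, ← Q.map_smul, ← Q.map_add, ← hx.apply_eq], hω⟩

end Gluing

section Nilpotent

omit [FiniteDimensional ℂ V] in
theorem exists_apply_eq_one {b : BilinForm ℂ V} (hbn : b.SeparatingLeft) {D : V →ₗ[ℂ] V}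
    (hD0 : D ≠ 0) : ∃ x y, b (D x) y = 1 := by
  obtain ⟨x, hx⟩ : ∃ x, D x ≠ 0 := by
    by_contra! h
    exact hD0 (LinearMap.ext h)
  obtain ⟨y, hy⟩ : ∃ y, b (D x) y ≠ 0 := by
    by_contra! h
    exact hx (hbn _ h)
  exact ⟨x, (b (D x) y)⁻¹ • y, by simp [hy]⟩

omit [FiniteDimensional ℂ V] in
theorem exists_apply_apply_eq_one {b : BilinForm ℂ V} (hb : ∀ x y, b x y = b y x)
    (hbn : b.SeparatingLeft) {D : V →ₗ[ℂ] V} (hD : ∀ x y, b (D x) y = -b x (D y))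
    (hD2 : ¬ ∀ x, D (D x) = 0) : ∃ x, b (D x) (D x) = 1 := by
  obtain ⟨x, hx⟩ : ∃ x, b (D x) (D x) ≠ 0 := by
    by_contra! h
    refine hD2 fun x => hbn _ fun y => ?_
    have hxy := h (x + y)
    simp only [map_add, LinearMap.add_apply, h, hb (D y) (D x)] at hxy
    rw [hD]
    linear_combination -hxy / 2
  obtain ⟨c, hc⟩ := IsAlgClosed.exists_pow_nat_eq (b (D x) (D x))⁻¹ (n := 2) two_pos
  refine ⟨c • x, ?_⟩
  simp only [map_smul, LinearMap.smul_apply, smul_eq_mul, ← mul_assoc, ← pow_two, hc]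
  exact inv_mul_cancel₀ hx

/-- Skew endomorphisms of rank at most two whose cube vanishes are conjugate, compatibly with
their alternating forms, as soon as they have the same nilpotency index. -/
theorem exists_intertwiner_of_rank_le_two {b : BilinForm ℂ V} {b' : BilinForm ℂ V'}
    {D : V →ₗ[ℂ] V} {D' : V' →ₗ[ℂ] V'} (hb : ∀ x y, b x y = b y x) (hb' : ∀ x y, b' x y = b' y x)
    (hbn : b.SeparatingLeft) (hbn' : b'.SeparatingLeft)
    (hD : ∀ x y, b (D x) y = -b x (D y)) (hD' : ∀ x y, b' (D' x) y = -b' x (D' y))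
    (hdim : finrank ℂ V = finrank ℂ V') (hD0 : D ≠ 0) (hD0' : D' ≠ 0)
    (hr : finrank ℂ D.range ≤ 2) (hr' : finrank ℂ D'.range ≤ 2)
    (h3 : ∀ x, D (D (D x)) = 0) (h3' : ∀ x, D' (D' (D' x)) = 0)
    (h2 : (∀ x, D (D x) = 0) ↔ ∀ x, D' (D' x) = 0) :
    ∃ Q : V ≃ₗ[ℂ] V', (∀ x, D' (Q x) = Q (D x)) ∧
      ∀ x y, b' (D' (Q x)) (Q y) = b (D x) y := by
  by_cases hsq : ∀ x, D (D x) = 0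
  · have hsq' := h2.1 hsq
    obtain ⟨x₁, x₂, hx⟩ := exists_apply_eq_one hbn hD0
    obtain ⟨y₁, y₂, hy⟩ := exists_apply_eq_one hbn' hD0'
    have hu : LinearIndependent ℂ ![(⟨D x₁, hsq x₁⟩ : D.ker), ⟨D x₂, hsq x₂⟩] := by
      refine .of_comp D.ker.subtype ?_
      convert linearIndependent_of_apply_eq_one hb hD hx using 1
      ext i; fin_cases i <;> rfl
    have hu' : LinearIndependent ℂ ![(⟨D' y₁, hsq' y₁⟩ : D'.ker), ⟨D' y₂, hsq' y₂⟩] := by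
      refine .of_comp D'.ker.subtype ?_
      convert linearIndependent_of_apply_eq_one hb' hD' hy using 1
      ext i; fin_cases i <;> rfl
    exact (isSymplecticPair_of_apply_eq_one hb hD hr hx).exists_intertwiner_of_linearIndependent
      hb hb' hD hD' hdim (isSymplecticPair_of_apply_eq_one hb' hD' hr' hy) hu hu'
      fun Q _ _ h => ⟨h 0, h 1⟩
  · obtain ⟨x, hx⟩ := exists_apply_apply_eq_one hb hbn hD hsq
    obtain ⟨y, hy⟩ := exists_apply_apply_eq_one hb' hbn' hD' (h2.not.1 hsq)
    have hu : LinearIndependent ℂ fun _ : Unit => (⟨D (D x), h3 x⟩ : D.ker) := by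
      refine LinearIndependent.of_subsingleton () fun h => ?_
      have h0 : D (D x) = 0 := congrArg Subtype.val h
      rw [hD, h0] at hx
      simp at hx
    have hu' : LinearIndependent ℂ fun _ : Unit => (⟨D' (D' y), h3' y⟩ : D'.ker) := by
      refine LinearIndependent.of_subsingleton () fun h => ?_
      have h0 : D' (D' y) = 0 := congrArg Subtype.val h
      rw [hD', h0] at hy
      simp at hy
    exact (isSymplecticPair_of_apply_eq_one hb hD hr hx).exists_intertwiner_of_linearIndependent
      hb hb' hD hD' hdim (isSymplecticPair_of_apply_eq_one hb' hD' hr' hy) hu hu'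
      fun Q _ h₂ h => ⟨h₂, h ()⟩

end Nilpotent

end LinearAlgebra

section DoubleExtension

open Module

theorem LieEquiv.apply_zero {g g' : Type*} [LieRing g] [LieAlgebra ℂ g] [LieRing g']
    [LieAlgebra ℂ g'] (A : g ≃ₗ⁅ℂ⁆ g') : A 0 = 0 := A.toLinearEquiv.map_zero

theorem mem_orthoPair {g : Type*} [LieRing g] [LieAlgebra ℂ g] {B : LinearMap.BilinForm ℂ g}
    {X0 Y0 x : g} : x ∈ orthoPair B X0 Y0 ↔ B x X0 = 0 ∧ B x Y0 = 0 := Iff.rfl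

/-- `B` is a quadratic structure on the Lie algebra `g` with double-extension data `(X0, Y0)`. -/
structure IsDoubleExtension {g : Type*} [LieRing g] [LieAlgebra ℂ g]
    (B : LinearMap.BilinForm ℂ g) (X0 Y0 : g) : Prop where
  symm : ∀ x y : g, B x y = B y x
  nondegenerate : B.Nondegenerate
  invariant : ∀ x y z : g, B ⁅x, y⁆ z = B x ⁅y, z⁆
  X0_X0 : B X0 X0 = 0
  Y0_Y0 : B Y0 Y0 = 0
  X0_Y0 : B X0 Y0 = 1
  lie_Y0_X0 : ⁅Y0, X0⁆ = 0
  lie_eq : ∀ X Y : g, ⁅X, Y⁆ = B X0 X • ⁅Y0, Y⁆ - B X0 Y • ⁅Y0, X⁆ + B ⁅Y0, X⁆ Y • X0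

namespace IsDoubleExtension

variable {g : Type*} [LieRing g] [LieAlgebra ℂ g] {B : LinearMap.BilinForm ℂ g} {X0 Y0 : g}
  (h : IsDoubleExtension B X0 Y0)

include h

theorem Y0_X0 : B Y0 X0 = 1 := by rw [h.symm, h.X0_Y0]

theorem lie_X0 (v : g) : ⁅v, X0⁆ = 0 := by
  have hv : B ⁅Y0, v⁆ X0 = 0 := by
    rw [← lie_skew, map_neg, LinearMap.neg_apply, h.invariant, h.lie_Y0_X0, map_zero, neg_zero]
  rw [h.lie_eq, h.lie_Y0_X0, h.X0_X0, hv]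
  simp

theorem lie_Y0_mem (v : g) : ⁅Y0, v⁆ ∈ orthoPair B X0 Y0 := by
  refine mem_orthoPair.2 ⟨by rw [h.invariant, h.lie_X0, map_zero], ?_⟩
  rw [h.symm, ← h.invariant, lie_self, map_zero, LinearMap.zero_apply]

/-- The endomorphism of `q = span{X0, Y0}ᗮ` induced by `ad Y0`. -/
noncomputable def der : orthoPair B X0 Y0 →ₗ[ℂ] orthoPair B X0 Y0 :=
  (LieAlgebra.ad ℂ g Y0).restrict fun v _ => h.lie_Y0_mem v

theorem coe_der (x : orthoPair B X0 Y0) : (h.der x : g) = ⁅Y0, (x : g)⁆ := rfl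

/-- The projection onto `q = span{X0, Y0}ᗮ`. -/
noncomputable def proj : g →ₗ[ℂ] orthoPair B X0 Y0 :=
  (LinearMap.id - ((B X0).smulRight Y0 + (B Y0).smulRight X0)).codRestrict _ fun v =>
    mem_orthoPair.2 (by
      constructor <;> simp [h.X0_X0, h.Y0_Y0, h.X0_Y0, h.Y0_X0, h.symm v])

theorem coe_proj (v : g) : (h.proj v : g) = v - (B X0 v • Y0 + B Y0 v • X0) := rfl

theorem proj_add (v : g) : (h.proj v : g) + (B X0 v • Y0 + B Y0 v • X0) = v := by
  rw [coe_proj, sub_add_cancel]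

theorem X0_coe (x : orthoPair B X0 Y0) : B X0 x = 0 := by rw [h.symm]; exact (mem_orthoPair.1 x.2).1

theorem Y0_coe (x : orthoPair B X0 Y0) : B Y0 x = 0 := by rw [h.symm]; exact (mem_orthoPair.1 x.2).2

theorem proj_coe (x : orthoPair B X0 Y0) : h.proj x = x :=
  Subtype.ext (by simp [coe_proj, h.X0_coe, h.Y0_coe])

theorem proj_X0 : h.proj X0 = 0 := Subtype.ext (by simp [coe_proj, h.X0_X0, h.Y0_X0])

theorem proj_Y0 : h.proj Y0 = 0 := Subtype.ext (by simp [coe_proj, h.Y0_Y0, h.X0_Y0])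

theorem ext_coord {u v : g} (hX : B X0 u = B X0 v) (hY : B Y0 u = B Y0 v)
    (hp : h.proj u = h.proj v) : u = v := by
  rw [← h.proj_add u, ← h.proj_add v, hX, hY, hp]

/-- The coordinates of a vector along `q`, `Y0` and `X0`. -/
noncomputable def coordEquiv : g ≃ₗ[ℂ] orthoPair B X0 Y0 × ℂ × ℂ :=
  LinearEquiv.ofBijective (h.proj.prod ((B X0).prod (B Y0)))
    ⟨fun u v huv => by
      simp only [LinearMap.prod_apply, Function.prod, Prod.mk.injEq] at huv
      exact h.ext_coord huv.2.1 huv.2.2 huv.1,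
    fun ⟨x, a, b⟩ => ⟨x + (a • Y0 + b • X0), by
      simp [h.proj_coe, h.proj_X0, h.proj_Y0, h.X0_coe, h.Y0_coe, h.X0_X0, h.Y0_Y0, h.X0_Y0,
        h.Y0_X0]⟩⟩

theorem coordEquiv_apply (v : g) : h.coordEquiv v = (h.proj v, B X0 v, B Y0 v) := rfl

theorem finrank_orthoPair [Module.Finite ℂ g] :
    finrank ℂ g = finrank ℂ (orthoPair B X0 Y0) + 2 := by
  rw [h.coordEquiv.finrank_eq, finrank_prod, finrank_prod, finrank_self]

theorem lie_Y0_eq (v : g) : ⁅Y0, v⁆ = h.der (h.proj v) := by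
  conv_lhs => rw [← h.proj_add v]
  simp [coe_der, h.lie_X0]

theorem X0_lie (u v : g) : B X0 ⁅u, v⁆ = 0 := by
  rw [h.symm, h.invariant, h.lie_X0, map_zero]

theorem Y0_lie (u v : g) : B Y0 ⁅u, v⁆ = B (h.der (h.proj u)) (h.proj v) := by
  rw [← h.invariant, h.lie_Y0_eq]
  conv_lhs => rw [← h.proj_add v]
  simp [h.symm _ X0, h.symm _ Y0, h.X0_coe, h.Y0_coe]

theorem proj_lie (u v : g) :
    h.proj ⁅u, v⁆ = B X0 u • h.der (h.proj v) - B X0 v • h.der (h.proj u) := by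
  rw [h.lie_eq, h.lie_Y0_eq, h.lie_Y0_eq]
  simp [h.proj_coe, h.proj_X0]

theorem restrict_symm (x y : orthoPair B X0 Y0) :
    B.restrict (orthoPair B X0 Y0) x y = B.restrict (orthoPair B X0 Y0) y x := h.symm _ _

theorem restrict_separatingLeft :
    LinearMap.SeparatingLeft (B.restrict (orthoPair B X0 Y0)) := by
  intro x hx
  refine Subtype.ext (h.nondegenerate.1 _ fun v => ?_)
  have hv : B x (h.proj v) = 0 := hx (h.proj v)
  rw [← h.proj_add v]
  simp [hv, h.symm _ X0, h.symm _ Y0, h.X0_coe, h.Y0_coe]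

theorem der_skew (x y : orthoPair B X0 Y0) :
    B.restrict (orthoPair B X0 Y0) (h.der x) y = -B.restrict (orthoPair B X0 Y0) x (h.der y) := by
  change B ⁅Y0, (x : g)⁆ y = -B x ⁅Y0, (y : g)⁆
  rw [← lie_skew, map_neg, LinearMap.neg_apply, h.invariant]

theorem lie_coe (x y : orthoPair B X0 Y0) : ⁅(x : g), (y : g)⁆ = B (h.der x) y • X0 := by
  rw [h.lie_eq, h.X0_coe, h.X0_coe, coe_der]
  simp

theorem X0_ne_zero : X0 ≠ 0 := by
  rintro rfl
  simpa using h.X0_Y0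

theorem der_eq_zero_iff : h.der = 0 ↔ ∀ u v : g, ⁅u, v⁆ = 0 := by
  constructor
  · intro hd u v
    apply h.ext_coord <;> simp [h.X0_lie, h.Y0_lie, h.proj_lie, hd]
  · exact fun hl => LinearMap.ext fun x => Subtype.ext (hl _ _)

theorem der_der_eq_zero_iff :
    (∀ x, h.der (h.der x) = 0) ↔ ∀ u v w : g, ⁅u, ⁅v, w⁆⁆ = 0 := by
  constructor
  · intro hd u v w
    have hdp : h.der (h.proj ⁅v, w⁆) = 0 := by simp [h.proj_lie, hd]
    have hB : B (h.der (h.proj u)) (h.proj ⁅v, w⁆) = 0 := by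
      have := h.der_skew (h.proj u) (h.proj ⁅v, w⁆)
      rw [hdp, map_zero, neg_zero] at this
      exact this
    apply h.ext_coord
    · simp [h.X0_lie]
    · rw [h.Y0_lie, hB, map_zero]
    · rw [h.proj_lie, hdp, h.X0_lie]
      simp
  · exact fun hl x => Subtype.ext (hl _ _ _)

theorem lie_eq_of_X0_eq_zero {v : g} (hv : B X0 v = 0) (w : g) :
    ⁅v, w⁆ = B (h.der (h.proj v)) (h.proj w) • X0 - B X0 w • (h.der (h.proj v) : g) := by
  apply h.ext_coord
  · simp [h.X0_lie, h.X0_X0, h.X0_coe]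
  · simp [h.Y0_lie, h.Y0_X0, h.Y0_coe]
  · simp [h.proj_lie, hv, h.proj_X0, h.proj_coe]

variable {g' : Type*} [LieRing g'] [LieAlgebra ℂ g'] {B' : LinearMap.BilinForm ℂ g'} {X0' Y0' : g'}
  (h' : IsDoubleExtension B' X0' Y0')

include h'

theorem nonempty_lieEquiv {lam : ℂ} (hlam : lam ≠ 0)
    (Q : orthoPair B X0 Y0 ≃ₗ[ℂ] orthoPair B' X0' Y0')
    (hQ : ∀ x, h'.der (Q x) = lam • Q (h.der x))
    (hω : ∀ x y, B' (h'.der (Q x)) (Q y) = lam * B (h.der x) y) : Nonempty (g ≃ₗ⁅ℂ⁆ g') := by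
  let A : g ≃ₗ[ℂ] g' := h.coordEquiv ≪≫ₗ
    Q.prodCongr ((LinearEquiv.smulOfNeZero ℂ ℂ lam⁻¹ (inv_ne_zero hlam)).prodCongr
      (LinearEquiv.smulOfNeZero ℂ ℂ lam hlam)) ≪≫ₗ h'.coordEquiv.symm
  have hA : ∀ v, (h'.proj (A v), B' X0' (A v), B' Y0' (A v)) =
      (Q (h.proj v), lam⁻¹ * B X0 v, lam * B Y0 v) := fun v => by
    rw [← coordEquiv_apply]
    exact h'.coordEquiv.apply_symm_apply _
  simp only [Prod.mk.injEq] at hA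
  obtain ⟨hp, hX, hY⟩ : (∀ v, h'.proj (A v) = Q (h.proj v)) ∧
      (∀ v, B' X0' (A v) = lam⁻¹ * B X0 v) ∧ ∀ v, B' Y0' (A v) = lam * B Y0 v :=
    ⟨fun v => (hA v).1, fun v => (hA v).2.1, fun v => (hA v).2.2⟩
  refine ⟨{ A with map_lie' := fun {u v} => ?_ }⟩
  change A ⁅u, v⁆ = ⁅A u, A v⁆
  apply h'.ext_coord
  · rw [hX, h.X0_lie, h'.X0_lie, mul_zero]
  · rw [hY, h.Y0_lie, h'.Y0_lie, hp, hp, hω]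
  · rw [hp, h.proj_lie, h'.proj_lie, hX, hX, hp, hp, hQ, hQ, map_sub, map_smul, map_smul,
      smul_smul, smul_smul]
    congr 2 <;> field_simp

/-- The case of an isomorphism preserving the ideals `X0ᗮ`. -/
theorem exists_intertwiner_of_preserves [Module.Finite ℂ g] [Module.Finite ℂ g']
    (A : g ≃ₗ⁅ℂ⁆ g') (hd : h.der ≠ 0)
    (hA : ∀ v, B X0 v = 0 → B' X0' (A v) = 0) :
    ∃ lam : ℂ, lam ≠ 0 ∧ ∃ Q : orthoPair B X0 Y0 ≃ₗ[ℂ] orthoPair B' X0' Y0',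
      (∀ x, h'.der (Q x) = lam • Q (h.der x)) ∧
      ∀ x y, B' (h'.der (Q x)) (Q y) = lam * B (h.der x) y := by
  have hdim : finrank ℂ (orthoPair B X0 Y0) = finrank ℂ (orthoPair B' X0' Y0') := by
    have := A.toLinearEquiv.finrank_eq
    rw [h.finrank_orthoPair, h'.finrank_orthoPair] at this
    omega
  obtain ⟨x₁, x₂, hx⟩ : ∃ x y : orthoPair B X0 Y0, B (h.der x) y = 1 :=
    exists_apply_eq_one h.restrict_separatingLeft hd
  have hXx : ∀ x : orthoPair B X0 Y0, B' X0' (A x) = 0 := fun x => hA _ (h.X0_coe x)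
  set ν := B' Y0' (A X0) with hν_def
  have hAX : A X0 = ν • X0' := by
    apply h'.ext_coord
    · simp [hA X0 h.X0_X0, h'.X0_X0]
    · simp [h'.Y0_X0, ν]
    · have : X0 = ⁅(x₁ : g), (x₂ : g)⁆ := by rw [h.lie_coe, hx, one_smul]
      rw [this, LieEquiv.map_lie, h'.proj_lie, hXx, hXx]
      simp [h'.proj_X0]
  have hν : ν ≠ 0 := fun h0 => h.X0_ne_zero (by
    rw [h0, zero_smul] at hAX
    exact A.injective (show A X0 = A 0 by rw [hAX, LieEquiv.apply_zero]))
  set μ := B' X0' (A Y0) with hμ_def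
  have hμ : μ ≠ 0 := fun h0 => by
    have hz : ∀ v, B' X0' (A v) = 0 := fun v => by
      have hv : B' X0' (A (v - B X0 v • Y0)) = 0 := hA _ (by simp [h.X0_Y0])
      have : A (v - B X0 v • Y0) = A v - B X0 v • A Y0 := by
        rw [← LieEquiv.coe_toLinearEquiv, map_sub, map_smul]
      rw [this, map_sub, map_smul, ← hμ_def, h0, smul_zero, sub_zero] at hv
      exact hv
    have := hz (A.symm Y0')
    rw [LieEquiv.apply_symm_apply, h'.X0_Y0] at this
    exact one_ne_zero this
  let R : orthoPair B X0 Y0 →ₗ[ℂ] orthoPair B' X0' Y0' :=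
    h'.proj ∘ₗ A.toLinearEquiv.toLinearMap ∘ₗ (orthoPair B X0 Y0).subtype
  have hR : ∀ x, R x = h'.proj (A x) := fun x => rfl
  have hRD : ∀ x, R (h.der x) = μ • h'.der (R x) := fun x => by
    rw [hR, coe_der, LieEquiv.map_lie, h'.proj_lie, hXx, zero_smul, sub_zero, hR]
  have hRω : ∀ x y, B' (h'.der (R x)) (R y) = ν * B (h.der x) y := fun x y => by
    rw [hR, hR, ← h'.Y0_lie, ← LieEquiv.map_lie, h.lie_coe, ← LieEquiv.coe_toLinearEquiv,
      map_smul, map_smul, LieEquiv.coe_toLinearEquiv, smul_eq_mul, mul_comm]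
  have hinj : Function.Injective R := by
    rw [← LinearMap.ker_eq_bot, LinearMap.ker_eq_bot']
    intro x hx0
    have hAx : A x = A ((B' Y0' (A x) / ν) • X0) := by
      rw [← LieEquiv.coe_toLinearEquiv, map_smul, LieEquiv.coe_toLinearEquiv, hAX, smul_smul,
        div_mul_cancel₀ _ hν]
      apply h'.ext_coord
      · simp [hXx, h'.X0_X0]
      · simp [h'.Y0_X0]
      · rw [← hR, hx0, map_smul, h'.proj_X0, smul_zero]
    have hxX := A.injective hAx
    have := h.Y0_coe x
    rw [hxX, map_smul, h.Y0_X0, smul_eq_mul, mul_one] at this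
    exact Subtype.ext (by rw [hxX, this, zero_smul]; rfl)
  obtain ⟨c, hc⟩ := IsAlgClosed.exists_pow_nat_eq (μ * ν)⁻¹ (n := 2) two_pos
  have hc0 : c ≠ 0 := by
    rintro rfl
    rw [zero_pow two_ne_zero, eq_comm, inv_eq_zero] at hc
    exact mul_ne_zero hμ hν hc
  refine ⟨μ⁻¹, inv_ne_zero hμ,
    R.linearEquivOfInjective hinj hdim ≪≫ₗ LinearEquiv.smulOfNeZero ℂ _ c hc0, ?_, ?_⟩
  · intro x
    change h'.der (c • R x) = μ⁻¹ • c • R (h.der x)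
    rw [hRD, map_smul, smul_comm c μ, inv_smul_smul₀ hμ]
  · intro x y
    change B' (h'.der (c • R x)) ((c • R y : orthoPair B' X0' Y0') : g') = _
    rw [map_smul, Submodule.coe_smul, Submodule.coe_smul, map_smul, map_smul,
      LinearMap.smul_apply, hRω, smul_eq_mul, smul_eq_mul]
    rw [mul_inv] at hc
    have : c ^ 2 * ν = μ⁻¹ := by rw [hc]; field_simp
    rw [← this]
    ring

/-- If an isomorphism does not preserve the ideals `X0ᗮ`, then the derivation has rank at most two
and vanishing cube. -/
theorem rank_le_two_and_cube_eq_zero (A : g ≃ₗ⁅ℂ⁆ g') {v : g} (hv : B X0 v = 0)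
    (hAv : B' X0' (A v) ≠ 0) :
    finrank ℂ h'.der.range ≤ 2 ∧ ∀ x, h'.der (h'.der (h'.der x)) = 0 := by
  have hproj : ∀ z, B' X0' z = 0 → h'.proj ⁅A v, z⁆ = B' X0' (A v) • h'.der (h'.proj z) :=
    fun z hz => by rw [h'.proj_lie, hz, zero_smul, sub_zero]
  constructor
  · have hle : h'.der.range ≤ Submodule.span ℂ
        (Set.range ![h'.proj (A X0), h'.proj (A (h.der (h.proj v)))]) := by
      rintro _ ⟨y, rfl⟩
      have hy := hproj y (h'.X0_coe y)
      rw [h'.proj_coe, ← A.apply_symm_apply (y : g'), ← LieEquiv.map_lie,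
        h.lie_eq_of_X0_eq_zero hv, ← LieEquiv.coe_toLinearEquiv, map_sub, map_smul, map_smul,
        map_sub, map_smul, map_smul] at hy
      rw [← inv_smul_smul₀ hAv (h'.der y)]
      refine Submodule.smul_mem _ _ (hy ▸ sub_mem ?_ ?_)
      · exact Submodule.smul_mem _ _ (Submodule.subset_span ⟨0, rfl⟩)
      · exact Submodule.smul_mem _ _ (Submodule.subset_span ⟨1, rfl⟩)
    have := FiniteDimensional.span_of_finite ℂ
      (Set.finite_range ![h'.proj (A X0), h'.proj (A (h.der (h.proj v)))])
    exact (Submodule.finrank_mono hle).trans (finrank_range_le_card _)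
  · intro x
    have hzero : ∀ w : g, ⁅v, ⁅v, ⁅v, w⁆⁆⁆ = 0 := fun w => by
      have hself : B (h.der (h.proj v)) (h.proj v) = 0 := by
        rw [← h.Y0_lie, lie_self, map_zero]
      rw [h.lie_eq_of_X0_eq_zero hv w, lie_sub, lie_smul, lie_smul, h.lie_X0, smul_zero, zero_sub,
        lie_neg, lie_smul, h.lie_eq_of_X0_eq_zero hv (h.der (h.proj v)), h.X0_coe, zero_smul,
        sub_zero, lie_smul, h.lie_X0, smul_zero, smul_zero, neg_zero]
    have hx := congrArg A (hzero (A.symm x))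
    rw [LieEquiv.map_lie, LieEquiv.map_lie, LieEquiv.map_lie, A.apply_symm_apply,
      LieEquiv.apply_zero] at hx
    have hp := hproj _ (h'.X0_lie (A v) ⁅A v, (x : g')⁆)
    rw [hx, map_zero, hproj _ (h'.X0_lie _ _), hproj _ (h'.X0_coe x), h'.proj_coe, map_smul,
      map_smul, map_smul] at hp
    simpa [hAv] using hp.symm

theorem exists_intertwiner [Module.Finite ℂ g] [Module.Finite ℂ g'] (A : g ≃ₗ⁅ℂ⁆ g') :
    ∃ lam : ℂ, lam ≠ 0 ∧ ∃ Q : orthoPair B X0 Y0 ≃ₗ[ℂ] orthoPair B' X0' Y0',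
      (∀ x, h'.der (Q x) = lam • Q (h.der x)) ∧
      ∀ x y, B' (h'.der (Q x)) (Q y) = lam * B (h.der x) y := by
  have hdim : finrank ℂ (orthoPair B X0 Y0) = finrank ℂ (orthoPair B' X0' Y0') := by
    have := A.toLinearEquiv.finrank_eq
    rw [h.finrank_orthoPair, h'.finrank_orthoPair] at this
    omega
  have hd_iff : h.der = 0 ↔ h'.der = 0 := by
    rw [h.der_eq_zero_iff, h'.der_eq_zero_iff]
    constructor
    · intro hl u v
      apply A.symm.injective
      change A.symm _ = A.symm _
      rw [LieEquiv.map_lie, hl, LieEquiv.apply_zero]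
    · intro hl u v
      apply A.injective
      change A _ = A _
      rw [LieEquiv.map_lie, hl, LieEquiv.apply_zero]
  have hdd_iff : (∀ x, h.der (h.der x) = 0) ↔ ∀ x, h'.der (h'.der x) = 0 := by
    rw [h.der_der_eq_zero_iff, h'.der_der_eq_zero_iff]
    constructor
    · intro hl u v w
      apply A.symm.injective
      change A.symm _ = A.symm _
      rw [LieEquiv.map_lie, LieEquiv.map_lie, hl, LieEquiv.apply_zero]
    · intro hl u v w
      apply A.injective
      change A _ = A _
      rw [LieEquiv.map_lie, LieEquiv.map_lie, hl, LieEquiv.apply_zero]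
  by_cases hd : h.der = 0
  · refine ⟨1, one_ne_zero, LinearEquiv.ofFinrankEq _ _ hdim, ?_, ?_⟩ <;>
      simp [hd, hd_iff.1 hd]
  by_cases hA : ∀ v, B X0 v = 0 → B' X0' (A v) = 0
  · exact exists_intertwiner_of_preserves h h' A hd hA
  push Not at hA
  obtain ⟨v, hv, hAv⟩ := hA
  obtain ⟨w, hw, hAw⟩ : ∃ w, B' X0' w = 0 ∧ B X0 (A.symm w) ≠ 0 := by
    by_contra! hcon
    have hlin : ∀ u, B X0 (A.symm u) = B' X0' u * B X0 (A.symm Y0') := fun u => by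
      have hu := hcon (u - B' X0' u • Y0') (by simp [h'.X0_Y0])
      rw [← LieEquiv.coe_toLinearEquiv, map_sub, map_smul, map_sub, map_smul, smul_eq_mul,
        LieEquiv.coe_toLinearEquiv] at hu
      exact sub_eq_zero.1 hu
    have h1 := hlin (A v)
    have h2 := hlin (A Y0)
    rw [A.symm_apply_apply, hv, eq_comm, mul_eq_zero, or_iff_right hAv] at h1
    rw [A.symm_apply_apply, h.X0_Y0, h1, mul_zero] at h2
    exact one_ne_zero h2
  obtain ⟨hr', h3'⟩ := rank_le_two_and_cube_eq_zero h h' A hv hAv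
  obtain ⟨hr, h3⟩ := rank_le_two_and_cube_eq_zero h' h A.symm hw hAw
  obtain ⟨Q, hQ, hω⟩ := exists_intertwiner_of_rank_le_two h.restrict_symm h'.restrict_symm
    h.restrict_separatingLeft h'.restrict_separatingLeft h.der_skew h'.der_skew hdim hd
    (hd_iff.not.1 hd) hr hr' h3 h3' hdd_iff
  exact ⟨1, one_ne_zero, Q, fun x => by rw [hQ, one_smul], fun x y => by
    rw [one_mul]; exact hω x y⟩

end IsDoubleExtension

end DoubleExtension

/-- Let `(g,B)` and `(g',B')` be quadratic Lie algebras with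
double-extension data `(X0,Y0)` and `(X0',Y0')`, and let `q`, `q'` be the orthogonals of
`span{X0,Y0}`, `span{X0',Y0'}`. Then `g ≅ g'` as Lie algebras if and only if there are a
nonzero `λ ∈ ℂ`, a linear bijection `Q̄ : q → q'` and a linear bijection `P̄ : q → q` with
(i) `[Y0', Q̄ x] = λ • Q̄ [Y0, x]`, (ii) `B(P̄ [Y0,x], P̄ y) = B([Y0,x], y)`, and
(iii) `B'(Q̄ x, Q̄ y) = B(P̄ x, P̄ y)` for all `x, y ∈ q`. -/
theorem isomorphic_iff_exists_PQ
    {g g' : Type*} [LieRing g] [LieAlgebra ℂ g] [Module.Finite ℂ g]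
    [LieRing g'] [LieAlgebra ℂ g'] [Module.Finite ℂ g']
    (B : LinearMap.BilinForm ℂ g) (B' : LinearMap.BilinForm ℂ g')
    (hsymm : ∀ x y : g, B x y = B y x)
    (hnondeg : B.Nondegenerate)
    (hinv : ∀ x y z : g, B ⁅x, y⁆ z = B x ⁅y, z⁆)
    (hsymm' : ∀ x y : g', B' x y = B' y x)
    (hnondeg' : B'.Nondegenerate)
    (hinv' : ∀ x y z : g', B' ⁅x, y⁆ z = B' x ⁅y, z⁆)
    (X0 Y0 : g) (X0' Y0' : g')
    (hX0 : B X0 X0 = 0) (hY0 : B Y0 Y0 = 0) (hXY : B X0 Y0 = 1)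
    (hYX : ⁅Y0, X0⁆ = 0)
    (hbracket : ∀ X Y : g,
      ⁅X, Y⁆ = B X0 X • ⁅Y0, Y⁆ - B X0 Y • ⁅Y0, X⁆ + B ⁅Y0, X⁆ Y • X0)
    (hX0' : B' X0' X0' = 0) (hY0' : B' Y0' Y0' = 0) (hXY' : B' X0' Y0' = 1)
    (hYX' : ⁅Y0', X0'⁆ = 0)
    (hbracket' : ∀ X Y : g',
      ⁅X, Y⁆ = B' X0' X • ⁅Y0', Y⁆ - B' X0' Y • ⁅Y0', X⁆ + B' ⁅Y0', X⁆ Y • X0')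
    (hq : ∀ x : g, x ∈ orthoPair B X0 Y0 → ⁅Y0, x⁆ ∈ orthoPair B X0 Y0)
    (hq' : ∀ x : g', x ∈ orthoPair B' X0' Y0' → ⁅Y0', x⁆ ∈ orthoPair B' X0' Y0') :
    Nonempty (g ≃ₗ⁅ℂ⁆ g') ↔
      (∃ lam : ℂ, lam ≠ 0 ∧
        ∃ Qbar : (orthoPair B X0 Y0) ≃ₗ[ℂ] (orthoPair B' X0' Y0'),
        ∃ Pbar : (orthoPair B X0 Y0) ≃ₗ[ℂ] (orthoPair B X0 Y0),
          (∀ x : orthoPair B X0 Y0,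
            ⁅Y0', (Qbar x : g')⁆ =
              lam • ((Qbar ⟨⁅Y0, (x : g)⁆, hq _ x.2⟩ : orthoPair B' X0' Y0') : g')) ∧
          (∀ x y : orthoPair B X0 Y0,
            B ((Pbar ⟨⁅Y0, (x : g)⁆, hq _ x.2⟩ : orthoPair B X0 Y0) : g) (Pbar y : g) =
              B ⁅Y0, (x : g)⁆ (y : g)) ∧
          (∀ x y : orthoPair B X0 Y0,
            B' (Qbar x : g') (Qbar y : g') = B (Pbar x : g) (Pbar y : g))) := by
  have h : IsDoubleExtension B X0 Y0 := ⟨hsymm, hnondeg, hinv, hX0, hY0, hXY, hYX, hbracket⟩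
  have h' : IsDoubleExtension B' X0' Y0' :=
    ⟨hsymm', hnondeg', hinv', hX0', hY0', hXY', hYX', hbracket'⟩
  constructor
  · rintro ⟨A⟩
    obtain ⟨lam, hlam, Q, hQ, hω⟩ := h.exists_intertwiner h' A
    obtain ⟨P, hP, hPQ⟩ := exists_isometry_correction h.restrict_symm h'.restrict_symm
      h.restrict_separatingLeft h'.restrict_separatingLeft hlam Q hQ hω
    exact ⟨lam, hlam, Q, P, fun x => congrArg Subtype.val (hQ x), hP, hPQ⟩
  · rintro ⟨lam, hlam, Q, P, hQ, hP, hPQ⟩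
    refine h.nonempty_lieEquiv h' hlam Q (fun x => Subtype.ext (hQ x)) fun x y => ?_
    rw [h'.coe_der, hQ, map_smul, LinearMap.smul_apply, smul_eq_mul, hPQ, hP]
    rfl
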